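/- arXiv:2208.14121 — 10 statements merged into one kernel-verified Lean document; each statement's English description precedes it below -/
import Mathlib

section
/- Let λ > 0, c > 0, u_r^R ∈ ℝ, p′ ∈ (0,1) and Φ₀ ∈ ℝ. Define φ(p) = ((p−p′)/(1−p′))·u_r^R + ((1−p)/(1−p′))·Φ₀ − [ (p−p′)/(1−p′) + (1−p)·ln( (p/(1−p))·((1−p′)/p′) ) ]·(c/λ) for p ∈ (0,1). Then φ(p′) = Φ₀, and φ is differentiable on (0,1) with c = λ·p·(u_r^R − φ(p)) − λ·p·(1−p)·φ′(p) for all p ∈ (0,1); that is, φ is the solution of the Bayesian Hamilton–Jacobi–Bellman ODE with boundary value (p′, Φ₀). -/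
/-- The closed-form function φ solves the Bayesian Hamilton–Jacobi–Bellman
ODE c = λp(u_r^R − φ(p)) − λp(1−p)φ′(p) on (0,1) with boundary value φ(p′) = Φ₀. -/
theorem bayesian_hjb_closed_form_solution
    (lam c urR p' Φ0 : ℝ) (hlam : 0 < lam) (hc : 0 < c)
    (hp'0 : 0 < p') (hp'1 : p' < 1)
    (φ : ℝ → ℝ)
    (hφ : ∀ p, φ p =
      (p - p') / (1 - p') * urR + (1 - p) / (1 - p') * Φ0 -
        ((p - p') / (1 - p') +
          (1 - p) * Real.log (p / (1 - p) * ((1 - p') / p'))) * (c / lam)) :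
    φ p' = Φ0 ∧
      ∀ p, 0 < p → p < 1 →
        DifferentiableAt ℝ φ p ∧
          c = lam * p * (urR - φ p) - lam * p * (1 - p) * deriv φ p := by
  have h1p' : 1 - p' ≠ 0 := by linarith
  have hp' : p' ≠ 0 := hp'0.ne'
  refine ⟨?_, fun p hp0 hp1 => ?_⟩
  · have harg : p' / (1 - p') * ((1 - p') / p') = 1 := by field_simp
    rw [hφ, harg, Real.log_one, sub_self, div_self h1p']
    ring
  · have hp : p ≠ 0 := hp0.ne'
    have h1p : 1 - p ≠ 0 := by linarith
    have hsub : HasDerivAt (fun x : ℝ => 1 - x) (-1) p := (hasDerivAt_id p).const_sub 1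
    have hlin : HasDerivAt (fun x : ℝ => (x - p') / (1 - p')) (1 / (1 - p')) p :=
      ((hasDerivAt_id p).sub_const p').div_const _
    have hodds : p / (1 - p) * ((1 - p') / p') ≠ 0 :=
      mul_ne_zero (div_ne_zero hp h1p) (div_ne_zero h1p' hp')
    have hlog := (((hasDerivAt_id p).div hsub h1p).mul_const ((1 - p') / p')).log hodds
    have hderiv := ((hlin.mul_const urR).add ((hsub.div_const (1 - p')).mul_const Φ0)).sub
      ((hlin.add (hsub.mul hlog)).mul_const (c / lam))
    have hφ' := hderiv.congr_of_eventuallyEq (Filter.Eventually.of_forall hφ)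
    refine ⟨hφ'.differentiableAt, ?_⟩
    rw [hφ'.deriv, hφ p]
    simp only [id, Pi.div_apply]
    generalize Real.log (p / (1 - p) * ((1 - p') / p')) = L
    field_simp
    ring
end

section
/- Let λ > 0, c > 0, and payoff parameters with u_r^R > u_ℓ^R; set U_ℓ(p) = p·u_ℓ^R + (1−p)·u_ℓ^L and p_ℓ^B := c/(λ(u_r^R − u_ℓ^R)). Let p₀ ∈ (0,1) with p₀ > p_ℓ^B, let b ∈ (p₀, 1], and let φ be differentiable on [p₀, b) satisfying the Bayesian HJB ODE c = λp(u_r^R − φ(p)) − λp(1−p)φ′(p) on [p₀, b). If φ(p₀) ≥ U_ℓ(p₀), then φ(p) ≥ U_ℓ(p) for all p ∈ [p₀, b). -/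
/-- Single-crossing comparison: if φ solves the Bayesian HJB ODE on [p₀, b)
with p₀ above the Bayesian left stopping boundary, and φ(p₀) ≥ U_ℓ(p₀), then φ stays
weakly above U_ℓ on all of [p₀, b). -/
theorem phi_stays_above_Ul
    (lam c urR uℓR uℓL : ℝ) (hlam : 0 < lam) (hc : 0 < c)
    (hur : uℓR < urR)
    (p0 b : ℝ) (hp00 : 0 < p0) (hp01 : p0 < 1)
    (hp0B : c / (lam * (urR - uℓR)) < p0)
    (hb : p0 < b) (hb1 : b ≤ 1)
    (φ φ' : ℝ → ℝ)
    (hd : ∀ p ∈ Set.Ico p0 b, HasDerivAt φ (φ' p) p)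
    (hODE : ∀ p ∈ Set.Ico p0 b, c = lam * p * (urR - φ p) - lam * p * (1 - p) * φ' p)
    (hinit : p0 * uℓR + (1 - p0) * uℓL ≤ φ p0) :
    ∀ p ∈ Set.Ico p0 b, p * uℓR + (1 - p) * uℓL ≤ φ p := by
  have hΔ : 0 < lam * (urR - uℓR) := mul_pos hlam (sub_pos.mpr hur)
  have hp0B' : c < p0 * (lam * (urR - uℓR)) := (div_lt_iff₀ hΔ).mp hp0B
  -- The gap `φ - U_ℓ` divided by `1 - p` is monotone.
  have hderiv : ∀ p ∈ Set.Ico p0 b,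
      HasDerivAt (fun x => (φ x - (x * uℓR + (1 - x) * uℓL)) / (1 - x))
        (((φ' p - (uℓR - uℓL)) * (1 - p) + (φ p - (p * uℓR + (1 - p) * uℓL))) /
          (1 - p) ^ 2) p := by
    intro p hp
    have hp1 : 1 - p ≠ 0 := by linarith [hp.2]
    have hU : HasDerivAt (fun x : ℝ => x * uℓR + (1 - x) * uℓL) (uℓR - uℓL) p := by
      refine (((hasDerivAt_id p).mul_const uℓR).add
        (((hasDerivAt_id p).const_sub 1).mul_const uℓL)).congr_deriv ?_
      ring
    refine (((hd p hp).sub hU).div ((hasDerivAt_id p).const_sub 1) hp1).congr_deriv ?_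
    simp only [Pi.sub_apply, id]
    ring
  have hmono : MonotoneOn (fun x => (φ x - (x * uℓR + (1 - x) * uℓL)) / (1 - x))
      (Set.Ico p0 b) := by
    refine monotoneOn_of_deriv_nonneg (convex_Ico p0 b)
      (fun p hp => (hderiv p hp).continuousAt.continuousWithinAt)
      (fun p hp => (hderiv p (interior_subset hp)).differentiableAt.differentiableWithinAt) ?_
    intro p hp
    have hp' := interior_subset hp
    rw [(hderiv p hp').deriv]
    refine div_nonneg ?_ (sq_nonneg _)
    have hlp : 0 < lam * p := mul_pos hlam (hp00.trans_le hp'.1)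
    refine nonneg_of_mul_nonneg_right ?_ hlp
    have hstep : p0 * (lam * (urR - uℓR)) ≤ p * (lam * (urR - uℓR)) :=
      mul_le_mul_of_nonneg_right hp'.1 hΔ.le
    linear_combination hp0B'.le + hstep - hODE p hp'
  intro p hp
  have h := hmono (Set.left_mem_Ico.mpr hb) hp hp.1
  have h0 : 0 ≤ (φ p0 - (p0 * uℓR + (1 - p0) * uℓL)) / (1 - p0) :=
    div_nonneg (sub_nonneg.mpr hinit) (sub_nonneg.mpr hp01.le)
  have hp1 : 0 < 1 - p := by linarith [hp.2]
  have hgap := mul_nonneg (h0.trans h) hp1.le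
  rw [div_mul_cancel₀ _ hp1.ne'] at hgap
  exact sub_nonneg.mp hgap
end

section
/- Let λ > 0, c > 0, payoff parameters with δ_ℓ := u_ℓ^L − u_ℓ^R > 0, and define u₁ < u₂ by u_{1,2} := (u_r^R + u_ℓ^L)/2 ∓ √(((u_r^R − u_ℓ^L)/2)² + (c/λ)·δ_ℓ). Fix p̄₂ ∈ (0,1) and Φ₂ ∈ (u₁, u₂), and set C := ((u₂ − Φ₂)/(Φ₂ − u₁)) · ((1−p̄₂)/p̄₂)^{(u₂−u₁)/δ_ℓ} and V̂(p̄) := ( C·u₁ + ((1−p̄)/p̄)^{(u₂−u₁)/δ_ℓ}·u₂ ) / ( ((1−p̄)/p̄)^{(u₂−u₁)/δ_ℓ} + C ) for p̄ ∈ (0,1). Then V̂(p̄₂) = Φ₂, V̂ is differentiable on (0,1), and for all p̄ ∈ (0,1): p̄·(1−p̄)·V̂′(p̄) = (u_r^R − V̂(p̄))·(u_ℓ^L − V̂(p̄))/δ_ℓ − c/λ. -/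
/-- The derivative of a real power of the odds ratio `(1 - p) / p` on `(0, 1)`. -/
theorem hasDerivAt_odds_rpow (a : ℝ) {p : ℝ} (hp : p ∈ Set.Ioo (0 : ℝ) 1) :
    HasDerivAt (fun q : ℝ => ((1 - q) / q) ^ a)
      (-(a * ((1 - p) / p) ^ a) / (p * (1 - p))) p := by
  obtain ⟨h0, h1⟩ := hp
  have hq : 0 < 1 - p := sub_pos.2 h1
  have hodds : (1 - p) / p ≠ 0 := (div_pos hq h0).ne'
  have hd : HasDerivAt (fun q : ℝ => (1 - q) / q) ((-1 * p - (1 - p) * 1) / p ^ 2) p :=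
    ((hasDerivAt_id p).const_sub 1).div (hasDerivAt_id p) h0.ne'
  convert hd.rpow_const (p := a) (Or.inl hodds) using 1
  rw [Real.rpow_sub_one hodds]
  field_simp
  ring

/-- The derivative of the weighted mean of `u` and `v` with weights `C` and `X`. -/
theorem HasDerivAt.weighted_mean {X : ℝ → ℝ} {X' p : ℝ} (C u v : ℝ)
    (hX : HasDerivAt X X' p) (h : X p + C ≠ 0) :
    HasDerivAt (fun q => (C * u + X q * v) / (X q + C))
      (X' * (C * (v - u)) / (X p + C) ^ 2) p := by
  exact (((hX.mul_const v).const_add (C * u)).div (hX.add_const C) h).congr_deriv (by ring)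


/-- The closed-form V̂ solves the randomized-stopping ODE
p̄(1−p̄)V̂′(p̄) = (u_r^R − V̂)(u_ℓ^L − V̂)/δ_ℓ − c/λ on (0,1) with V̂(p̄₂) = Φ₂. -/
theorem Vhat_solves_randomized_stopping_ODE
    (lam c urR uℓR uℓL : ℝ) (hlam : 0 < lam) (hc : 0 < c)
    (hδ : 0 < uℓL - uℓR)
    (u1 u2 : ℝ)
    (hu1 : u1 = (urR + uℓL) / 2 -
      Real.sqrt (((urR - uℓL) / 2) ^ 2 + c / lam * (uℓL - uℓR)))
    (hu2 : u2 = (urR + uℓL) / 2 +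
      Real.sqrt (((urR - uℓL) / 2) ^ 2 + c / lam * (uℓL - uℓR)))
    (p2 Φ2 : ℝ) (hp2 : p2 ∈ Set.Ioo (0 : ℝ) 1) (hΦ2 : Φ2 ∈ Set.Ioo u1 u2)
    (C : ℝ)
    (hC : C = (u2 - Φ2) / (Φ2 - u1) * ((1 - p2) / p2) ^ ((u2 - u1) / (uℓL - uℓR)))
    (V : ℝ → ℝ)
    (hV : ∀ p : ℝ, V p =
      (C * u1 + ((1 - p) / p) ^ ((u2 - u1) / (uℓL - uℓR)) * u2) /
        (((1 - p) / p) ^ ((u2 - u1) / (uℓL - uℓR)) + C)) :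
    V p2 = Φ2 ∧
      ∀ p ∈ Set.Ioo (0 : ℝ) 1,
        DifferentiableAt ℝ V p ∧
          p * (1 - p) * deriv V p =
            (urR - V p) * (uℓL - V p) / (uℓL - uℓR) - c / lam := by
  obtain ⟨hΦ1, hΦ2⟩ := hΦ2
  have hΦ1' : 0 < Φ2 - u1 := sub_pos.2 hΦ1
  have hΦ2' : 0 < u2 - Φ2 := sub_pos.2 hΦ2
  have hodds : ∀ p ∈ Set.Ioo (0 : ℝ) 1, 0 < ((1 - p) / p) ^ ((u2 - u1) / (uℓL - uℓR)) :=
    fun p hp => Real.rpow_pos_of_pos (div_pos (sub_pos.2 hp.2) hp.1) _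
  have hCpos : 0 < C := hC ▸ mul_pos (div_pos hΦ2' hΦ1') (hodds p2 hp2)
  have hroots : ∀ x : ℝ,
      (urR - x) * (uℓL - x) - c / lam * (uℓL - uℓR) = (x - u1) * (x - u2) := by
    intro x
    have hs := Real.sq_sqrt (show 0 ≤ ((urR - uℓL) / 2) ^ 2 + c / lam * (uℓL - uℓR) by positivity)
    rw [hu1, hu2]
    linear_combination hs
  refine ⟨?_, fun p hp => ?_⟩
  · have hX := hodds p2 hp2
    have hsum := add_pos hX hCpos
    rw [hV, div_eq_iff hsum.ne']
    have hC' : C * (Φ2 - u1) = (u2 - Φ2) * ((1 - p2) / p2) ^ ((u2 - u1) / (uℓL - uℓR)) := by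
      rw [hC]
      field_simp
    linear_combination -hC'
  · have hX := hodds p hp
    have hsum := add_pos hX hCpos
    have hd := (hasDerivAt_odds_rpow ((u2 - u1) / (uℓL - uℓR)) hp).weighted_mean C u1 u2 hsum.ne'
    rw [← funext hV] at hd
    refine ⟨hd.differentiableAt, ?_⟩
    have hrhs : (urR - V p) * (uℓL - V p) / (uℓL - uℓR) - c / lam =
        (V p - u1) * (V p - u2) / (uℓL - uℓR) := by
      rw [← hroots, sub_div, mul_div_cancel_right₀ _ hδ.ne']
    have hp0 : p ≠ 0 := hp.1.ne'
    have hp1 : 1 - p ≠ 0 := (sub_pos.2 hp.2).ne'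
    rw [hd.deriv, hrhs, hV]
    generalize ((1 - p) / p) ^ ((u2 - u1) / (uℓL - uℓR)) = X at hX hsum ⊢
    have hsum' := hsum.ne'
    have hδ' := hδ.ne'
    field_simp
    ring
end

section
/- Let λ > 0, c > 0, payoff parameters with δ_ℓ := u_ℓ^L − u_ℓ^R > 0, and define u₁ < u₂ by u_{1,2} := (u_r^R + u_ℓ^L)/2 ∓ √(((u_r^R − u_ℓ^L)/2)² + (c/λ)·δ_ℓ). Fix p̄₂ ∈ (0,1) and Φ₂ ∈ (u₁, u₂), set C := ((u₂ − Φ₂)/(Φ₂ − u₁)) · ((1−p̄₂)/p̄₂)^{(u₂−u₁)/δ_ℓ} and V̂(p̄) := ( C·u₁ + ((1−p̄)/p̄)^{(u₂−u₁)/δ_ℓ}·u₂ ) / ( ((1−p̄)/p̄)^{(u₂−u₁)/δ_ℓ} + C ). Then C > 0, V̂ is strictly decreasing on (0,1), and u₁ < V̂(p̄) < u₂ for every p̄ ∈ (0,1). -/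
/-- A weighted mean of `a < b` is strictly increasing in the weight put on `b`. -/
theorem weighted_mean_lt_weighted_mean {a b C x y : ℝ} (hab : a < b) (hC : 0 < C)
    (hx : 0 < x) (hxy : x < y) :
    (C * a + x * b) / (x + C) < (C * a + y * b) / (y + C) := by
  rw [div_lt_div_iff₀ (by linarith) (by linarith)]
  nlinarith [mul_pos (mul_pos hC (sub_pos.2 hab)) (sub_pos.2 hxy)]

/-- A mean of `a < b` with positive weights lies strictly between `a` and `b`. -/
theorem weighted_mean_mem_Ioo {a b C x : ℝ} (hab : a < b) (hC : 0 < C) (hx : 0 < x) :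
    (C * a + x * b) / (x + C) ∈ Set.Ioo a b := by
  constructor
  · rw [lt_div_iff₀ (by linarith)]
    nlinarith [mul_pos hx (sub_pos.2 hab)]
  · rw [div_lt_iff₀ (by linarith)]
    nlinarith [mul_pos hC (sub_pos.2 hab)]

/-- A real power of the odds ratio `(1 - p) / p` is positive on `(0, 1)`. -/
theorem odds_rpow_pos {p : ℝ} (hp : p ∈ Set.Ioo (0 : ℝ) 1) (k : ℝ) :
    0 < ((1 - p) / p) ^ k :=
  Real.rpow_pos_of_pos (div_pos (sub_pos.2 hp.2) hp.1) k

/-- A positive power of the odds ratio `(1 - p) / p` is strictly decreasing on `(0, 1)`. -/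
theorem strictAntiOn_odds_rpow {k : ℝ} (hk : 0 < k) :
    StrictAntiOn (fun p : ℝ => ((1 - p) / p) ^ k) (Set.Ioo 0 1) := by
  intro p hp q hq hpq
  refine Real.rpow_lt_rpow (div_pos (sub_pos.2 hq.2) hq.1).le ?_ hk
  exact div_lt_div₀ (by linarith) hpq.le (sub_pos.2 hp.2).le hp.1

/-- Lemma 1(i): the integration constant C is positive, V̂ is strictly
decreasing on (0,1), and u₁ < V̂(p̄) < u₂ for every p̄ ∈ (0,1). -/
theorem Vhat_strictly_decreasing_and_bounded
    (lam c urR uℓR uℓL : ℝ) (hlam : 0 < lam) (hc : 0 < c)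
    (hδ : 0 < uℓL - uℓR)
    (u1 u2 : ℝ)
    (hu1 : u1 = (urR + uℓL) / 2 -
      Real.sqrt (((urR - uℓL) / 2) ^ 2 + c / lam * (uℓL - uℓR)))
    (hu2 : u2 = (urR + uℓL) / 2 +
      Real.sqrt (((urR - uℓL) / 2) ^ 2 + c / lam * (uℓL - uℓR)))
    (p2 Φ2 : ℝ) (hp2 : p2 ∈ Set.Ioo (0 : ℝ) 1) (hΦ2 : Φ2 ∈ Set.Ioo u1 u2)
    (C : ℝ)
    (hC : C = (u2 - Φ2) / (Φ2 - u1) * ((1 - p2) / p2) ^ ((u2 - u1) / (uℓL - uℓR)))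
    (V : ℝ → ℝ)
    (hV : ∀ p : ℝ, V p =
      (C * u1 + ((1 - p) / p) ^ ((u2 - u1) / (uℓL - uℓR)) * u2) /
        (((1 - p) / p) ^ ((u2 - u1) / (uℓL - uℓR)) + C)) :
    0 < C ∧
      StrictAntiOn V (Set.Ioo (0 : ℝ) 1) ∧
      ∀ p ∈ Set.Ioo (0 : ℝ) 1, u1 < V p ∧ V p < u2 := by
  have hu : u1 < u2 := hΦ2.1.trans hΦ2.2
  have hCpos : 0 < C := by
    rw [hC]
    exact mul_pos (div_pos (sub_pos.2 hΦ2.2) (sub_pos.2 hΦ2.1)) (odds_rpow_pos hp2 _)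
  refine ⟨hCpos, fun p hp q hq hpq => ?_, fun p hp => ?_⟩
  · rw [hV p, hV q]
    exact weighted_mean_lt_weighted_mean hu hCpos (odds_rpow_pos hq _)
      (strictAntiOn_odds_rpow (div_pos (sub_pos.2 hu) hδ) hp hq hpq)
  · rw [hV p]
    exact weighted_mean_mem_Ioo hu hCpos (odds_rpow_pos hp _)
end

section
/- Let λ > 0, c > 0, Δ > 0, and payoff parameters with u_r^R > u_ℓ^R and δ_ℓ := u_ℓ^L − u_ℓ^R > 0; let U_ℓ(p) = p·u_ℓ^R + (1−p)·u_ℓ^L, p_ℓ^B := c/(λ(u_r^R − u_ℓ^R)), and p̲_Δ(p̄) := p̄/(p̄ + (1−p̄)·e^{Δ}). Define u₁ < u₂ by u_{1,2} := (u_r^R + u_ℓ^L)/2 ∓ √(((u_r^R − u_ℓ^L)/2)² + (c/λ)·δ_ℓ), fix p̄₂ ∈ (0,1) and Φ₂ ∈ (u₁, u₂), and let V̂ be the closed-form solution V̂(p̄) := ( C·u₁ + ((1−p̄)/p̄)^{(u₂−u₁)/δ_ℓ}·u₂ ) / ( ((1−p̄)/p̄)^{(u₂−u₁)/δ_ℓ}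 + C ) with C := ((u₂ − Φ₂)/(Φ₂ − u₁))·((1−p̄₂)/p̄₂)^{(u₂−u₁)/δ_ℓ}. Assume (a) Φ₂ < U_ℓ(p̲_Δ(p̄₂)), (b) u₁ > u_ℓ^R, and (c) Φ₂ < U_ℓ(p_ℓ^B). Then there exists a unique p̄₃ ∈ (p̄₂, 1) such that V̂(p̄₃) = U_ℓ(p̲_Δ(p̄₃)). -/
/-- A difference of two logit functions, the second rescaled, is strictly increasing wherever its
derivative is forced to be positive by a comparison of the two quadratics. -/
theorem strictMonoOn_logit_sub_mul_logit {l₁ r₁ l₂ r₂ a m : ℝ} (hlr : l₁ < r₁) (hl : l₂ < l₁)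
    (hm₁ : m ≤ r₁) (hm₂ : m ≤ r₂) (ha : a * (r₂ - l₂) = r₁ - l₁)
    (hquad : ∀ y ∈ Set.Ioo l₁ m, (y - l₁) * (r₁ - y) < (y - l₂) * (r₂ - y)) :
    StrictMonoOn (fun y => Real.log (y - l₁) - Real.log (r₁ - y) -
      a * (Real.log (y - l₂) - Real.log (r₂ - y))) (Set.Ioo l₁ m) := by
  have hderiv : ∀ y ∈ Set.Ioo l₁ m, HasDerivAt (fun y => Real.log (y - l₁) - Real.log (r₁ - y) -
      a * (Real.log (y - l₂) - Real.log (r₂ - y)))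
      (1 / (y - l₁) - (-1) / (r₁ - y) - a * (1 / (y - l₂) - (-1) / (r₂ - y))) y := by
    rintro y ⟨hy₁, hy₂⟩
    have h₁ := ((hasDerivAt_id y).sub_const l₁).log (sub_ne_zero.2 hy₁.ne')
    have h₂ := ((hasDerivAt_id y).const_sub r₁).log (sub_pos.2 (hy₂.trans_le hm₁)).ne'
    have h₃ := ((hasDerivAt_id y).sub_const l₂).log (sub_pos.2 (hl.trans hy₁)).ne'
    have h₄ := ((hasDerivAt_id y).const_sub r₂).log (sub_pos.2 (hy₂.trans_le hm₂)).ne'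
    exact (h₁.sub h₂).sub ((h₃.sub h₄).const_mul a)
  refine strictMonoOn_of_deriv_pos (convex_Ioo _ _)
    (fun y hy => (hderiv y hy).continuousAt.continuousWithinAt) fun y hy => ?_
  rw [interior_Ioo] at hy
  rw [(hderiv y hy).deriv]
  have h₁ : 0 < y - l₁ := sub_pos.2 hy.1
  have h₂ : 0 < r₁ - y := sub_pos.2 (hy.2.trans_le hm₁)
  have h₃ : 0 < y - l₂ := sub_pos.2 (hl.trans hy.1)
  have h₄ : 0 < r₂ - y := sub_pos.2 (hy.2.trans_le hm₂)
  have e₁ : 1 / (y - l₁) - (-1) / (r₁ - y) = (r₁ - l₁) / ((y - l₁) * (r₁ - y)) := by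
    field_simp
    ring
  have e₂ : a * (1 / (y - l₂) - (-1) / (r₂ - y)) = (r₁ - l₁) / ((y - l₂) * (r₂ - y)) := by
    rw [← ha]
    field_simp
    ring
  rw [e₁, e₂, sub_pos]
  exact div_lt_div_of_pos_left (sub_pos.2 hlr) (mul_pos h₁ h₂) (hquad y hy)

/-- The logit of a weighted average of `l` and `r` is the logarithm of the ratio of weights. -/
theorem log_sub_log_weighted_average {l r t k y : ℝ} (hlr : l < r) (ht : 0 < t) (hk : 0 < k)
    (hy : y = (k * l + t * r) / (t + k)) :
    Real.log (y - l) - Real.log (r - y) = Real.log t - Real.log k := by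
  have hlr' : r - l ≠ 0 := (sub_pos.2 hlr).ne'
  have htk : t + k ≠ 0 := by positivity
  have e₁ : y - l = (r - l) * t / (t + k) := by
    rw [hy]; field_simp; ring
  have e₂ : r - y = (r - l) * k / (t + k) := by
    rw [hy]; field_simp; ring
  rw [e₁, e₂, Real.log_div (by positivity) htk, Real.log_div (by positivity) htk,
    Real.log_mul hlr' ht.ne', Real.log_mul hlr' hk.ne']
  ring

/-- Lemma 1(ii): under (a) Φ₂ < U_ℓ(p̲_Δ(p̄₂)), (b) u₁ > u_ℓ^R, and
(c) Φ₂ < U_ℓ(p_ℓ^B), there exists a unique p̄₃ ∈ (p̄₂, 1) with V̂(p̄₃) = U_ℓ(p̲_Δ(p̄₃)). -/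
theorem exists_unique_region3_right_boundary
    (lam c Δ urR uℓR uℓL : ℝ) (hlam : 0 < lam) (hc : 0 < c) (hΔ : 0 < Δ)
    (hur : uℓR < urR) (hδ : 0 < uℓL - uℓR)
    (u1 u2 : ℝ)
    (hu1 : u1 = (urR + uℓL) / 2 -
      Real.sqrt (((urR - uℓL) / 2) ^ 2 + c / lam * (uℓL - uℓR)))
    (hu2 : u2 = (urR + uℓL) / 2 +
      Real.sqrt (((urR - uℓL) / 2) ^ 2 + c / lam * (uℓL - uℓR)))
    (p2 Φ2 : ℝ) (hp2 : p2 ∈ Set.Ioo (0 : ℝ) 1) (hΦ2 : Φ2 ∈ Set.Ioo u1 u2)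
    (C : ℝ)
    (hC : C = (u2 - Φ2) / (Φ2 - u1) * ((1 - p2) / p2) ^ ((u2 - u1) / (uℓL - uℓR)))
    (V : ℝ → ℝ)
    (hV : ∀ p : ℝ, V p =
      (C * u1 + ((1 - p) / p) ^ ((u2 - u1) / (uℓL - uℓR)) * u2) /
        (((1 - p) / p) ^ ((u2 - u1) / (uℓL - uℓR)) + C))
    (pl : ℝ → ℝ) (hpl : ∀ p : ℝ, pl p = p / (p + (1 - p) * Real.exp Δ))
    (Uℓ : ℝ → ℝ) (hUℓ : ∀ p : ℝ, Uℓ p = p * uℓR + (1 - p) * uℓL)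
    (ha : Φ2 < Uℓ (pl p2))
    (hb : uℓR < u1)
    (hcΦ : Φ2 < Uℓ (c / (lam * (urR - uℓR)))) :
    ∃! p3 : ℝ, p3 ∈ Set.Ioo p2 1 ∧ V p3 = Uℓ (pl p3) := by
  obtain ⟨hp20, hp21⟩ := hp2
  obtain ⟨hΦ1, hΦu⟩ := hΦ2
  have hu12 : u1 < u2 := hΦ1.trans hΦu
  have hsum : u1 + u2 = urR + uℓL := by rw [hu1, hu2]; ring
  have hprod : u1 * u2 = urR * uℓL - c / lam * (uℓL - uℓR) := by
    have hsq := Real.sq_sqrt (show 0 ≤ ((urR - uℓL) / 2) ^ 2 + c / lam * (uℓL - uℓR) by positivity)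
    rw [hu1, hu2]
    linear_combination -hsq
  clear hu1 hu2
  set a := (u2 - u1) / (uℓL - uℓR) with ha_def
  have ha0 : 0 < a := div_pos (sub_pos.2 hu12) hδ
  have haδ : a * (uℓL - uℓR) = u2 - u1 := div_mul_cancel₀ _ hδ.ne'
  have hodds : ∀ p ∈ Set.Ico p2 1, 0 < (1 - p) / p := fun p hp =>
    div_pos (sub_pos.2 hp.2) (hp20.trans_le hp.1)
  have ht2 : 0 < ((1 - p2) / p2) ^ a := Real.rpow_pos_of_pos (hodds p2 ⟨le_rfl, hp21⟩) a
  have hC0 : 0 < C := by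
    rw [hC]
    exact mul_pos (div_pos (sub_pos.2 hΦu) (sub_pos.2 hΦ1)) ht2
  have hCmul : C * (Φ2 - u1) = (u2 - Φ2) * ((1 - p2) / p2) ^ a := by
    have := (sub_pos.2 hΦ1).ne'
    rw [hC]; field_simp
  have hV2 : V p2 = Φ2 := by
    rw [hV, div_eq_iff (by positivity)]
    linear_combination -hCmul
  have hU : ∀ p ∈ Set.Icc p2 1, Uℓ (pl p) =
      (1 * uℓR + (1 - p) / p * Real.exp Δ * uℓL) / ((1 - p) / p * Real.exp Δ + 1) := by
    intro p hp
    have hp0 : 0 < p := hp20.trans_le hp.1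
    have h1p : 0 ≤ 1 - p := sub_nonneg.2 hp.2
    have hE := Real.exp_pos Δ
    have hne : p + (1 - p) * Real.exp Δ ≠ 0 := by positivity
    have hne' : (1 - p) * Real.exp Δ + p ≠ 0 := by positivity
    rw [hUℓ, hpl]
    field_simp
    ring
  have hcut : Uℓ (c / (lam * (urR - uℓR))) < uℓL := by
    have : 0 < c / (lam * (urR - uℓR)) * (uℓL - uℓR) := by
      have := sub_pos.2 hur
      positivity
    rw [hUℓ]
    linarith
  have hquad : ∀ y ∈ Set.Ioo u1 Φ2, (y - u1) * (u2 - y) < (y - uℓR) * (uℓL - y) := by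
    intro y hy
    have hd := sub_pos.2 hur
    have h₁ : c / (lam * (urR - uℓR)) * (uℓL - uℓR) < uℓL - y := by
      have := hy.2.trans hcΦ
      rw [hUℓ] at this
      linarith
    have h₂ : c / lam * (uℓL - uℓR) < (uℓL - y) * (urR - uℓR) := by
      calc c / lam * (uℓL - uℓR)
          = c / (lam * (urR - uℓR)) * (uℓL - uℓR) * (urR - uℓR) := by field_simp
        _ < _ := mul_lt_mul_of_pos_right h₁ hd
    have h₃ : (y - u1) * (u2 - y) = (uℓL - y) * (y - urR) + c / lam * (uℓL - uℓR) := by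
      linear_combination y * hsum - hprod
    rw [h₃]
    linarith
  have hmono := strictMonoOn_logit_sub_mul_logit hu12 hb hΦu.le (hcΦ.trans hcut).le haδ hquad
  have hmem : ∀ p ∈ Set.Ioo p2 1, V p ∈ Set.Ioo u1 Φ2 := by
    intro p hp
    have hs := hodds p ⟨hp.1.le, hp.2⟩
    have ht : 0 < ((1 - p) / p) ^ a := Real.rpow_pos_of_pos hs a
    have hlt : ((1 - p) / p) ^ a < ((1 - p2) / p2) ^ a := by
      refine Real.rpow_lt_rpow hs.le ?_ ha0
      rw [div_lt_div_iff₀ (hp20.trans hp.1) hp20]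
      linarith [hp.1]
    rw [hV]
    constructor
    · rw [lt_div_iff₀ (by positivity)]
      linarith [mul_lt_mul_of_pos_left hu12 ht]
    · rw [div_lt_iff₀ (by positivity)]
      linarith [mul_lt_mul_of_pos_left hlt (sub_pos.2 hΦu)]
  have hlogV : ∀ p ∈ Set.Ioo p2 1, Real.log (V p - u1) - Real.log (u2 - V p) =
      a * Real.log ((1 - p) / p) - Real.log C := by
    intro p hp
    have hs := hodds p ⟨hp.1.le, hp.2⟩
    rw [log_sub_log_weighted_average hu12 (Real.rpow_pos_of_pos hs a) hC0 (hV p),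
      Real.log_rpow hs]
  have hlogU : ∀ p ∈ Set.Ioo p2 1, Real.log (Uℓ (pl p) - uℓR) - Real.log (uℓL - Uℓ (pl p)) =
      Real.log ((1 - p) / p) + Δ := by
    intro p hp
    have hs := hodds p ⟨hp.1.le, hp.2⟩
    rw [log_sub_log_weighted_average (sub_pos.1 hδ) (mul_pos hs (Real.exp_pos Δ)) one_pos
      (hU p ⟨hp.1.le, hp.2.le⟩), Real.log_mul hs.ne' (Real.exp_pos Δ).ne', Real.log_exp,
      Real.log_one, sub_zero]
  have hcross : ∀ p ∈ Set.Ioo p2 1, V p = Uℓ (pl p) →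
      Real.log (V p - u1) - Real.log (u2 - V p) -
        a * (Real.log (V p - uℓR) - Real.log (uℓL - V p)) = -Real.log C - a * Δ := by
    intro p hp hpe
    rw [hlogV p hp, hpe, hlogU p hp]
    ring
  have huniq : ∀ p ∈ Set.Ioo p2 1, ∀ q ∈ Set.Ioo p2 1, V p = Uℓ (pl p) → V q = Uℓ (pl q) →
      p = q := by
    intro p hp q hq hpe hqe
    have hVeq : V p = V q := hmono.injOn (hmem p hp) (hmem q hq)
      ((hcross p hp hpe).trans (hcross q hq hqe).symm)
    have hlog : Real.log ((1 - p) / p) = Real.log ((1 - q) / q) := by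
      have h₁ := hlogU p hp
      have h₂ := hlogU q hq
      rw [← hpe, hVeq] at h₁
      rw [← hqe] at h₂
      linarith
    have hs := Real.log_injOn_pos (hodds p ⟨hp.1.le, hp.2⟩) (hodds q ⟨hq.1.le, hq.2⟩) hlog
    rw [div_eq_div_iff (hp20.trans hp.1).ne' (hp20.trans hq.1).ne'] at hs
    linarith
  have hcontOdds : ContinuousOn (fun p : ℝ => (1 - p) / p) (Set.Icc p2 1) :=
    (continuousOn_const.sub continuousOn_id).div continuousOn_id
      fun p hp => (hp20.trans_le hp.1).ne'
  have hodds0 : ∀ p ∈ Set.Icc p2 1, 0 ≤ (1 - p) / p := fun p hp =>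
    div_nonneg (sub_nonneg.2 hp.2) (hp20.trans_le hp.1).le
  have hcontV : ContinuousOn V (Set.Icc p2 1) := by
    have hpow : ContinuousOn (fun p : ℝ => ((1 - p) / p) ^ a) (Set.Icc p2 1) :=
      hcontOdds.rpow_const fun _ _ => Or.inr ha0.le
    rw [funext hV]
    refine (continuousOn_const.add (hpow.mul continuousOn_const)).div
      (hpow.add continuousOn_const) fun p hp => ?_
    have := Real.rpow_nonneg (hodds0 p hp) a
    positivity
  have hcontU : ContinuousOn (fun p => Uℓ (pl p)) (Set.Icc p2 1) := by
    refine ContinuousOn.congr (ContinuousOn.div ?_ ?_ fun p hp => ?_) hU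
    · exact continuousOn_const.add ((hcontOdds.mul continuousOn_const).mul continuousOn_const)
    · exact (hcontOdds.mul continuousOn_const).add continuousOn_const
    · have := mul_nonneg (hodds0 p hp) (Real.exp_pos Δ).le
      positivity
  have hV1 : V 1 = u1 := by
    rw [hV, sub_self, zero_div, Real.zero_rpow ha0.ne']
    field_simp
    ring
  have hU1 : Uℓ (pl 1) = uℓR := by
    rw [hU 1 ⟨hp21.le, le_rfl⟩]
    simp
  obtain ⟨p, hp, hp0⟩ := intermediate_value_Ioo hp21.le (hcontV.sub hcontU)
    (show (0 : ℝ) ∈ Set.Ioo (V p2 - Uℓ (pl p2)) (V 1 - Uℓ (pl 1)) from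
      ⟨by rw [hV2]; linarith, by rw [hV1, hU1]; linarith⟩)
  exact ⟨p, ⟨hp, sub_eq_zero.1 hp0⟩, fun q hq => huniq q hq.1 p hp hq.2 (sub_eq_zero.1 hp0)⟩
end

section
/- Let λ > 0, c > 0, Δ ∈ ℝ, and payoff parameters u_r^R, u_ℓ^R, u_ℓ^L with δ_ℓ := u_ℓ^L − u_ℓ^R > 0; let U_ℓ(p) = p·u_ℓ^R + (1−p)·u_ℓ^L and p̲_Δ(p̄) := p̄/(p̄ + (1−p̄)·e^{Δ}). Suppose V̂ is differentiable at p̄ ∈ (0,1) with p̄(1−p̄)·V̂′(p̄) = (u_r^R − V̂(p̄))·(u_ℓ^L − V̂(p̄))/δ_ℓ − c/λ, and suppose the value-matching condition V̂(p̄) = U_ℓ(p̲_Δ(p̄)) holds. Then the function g(q) := V̂(q) − U_ℓ(p̲_Δ(q)) is differentiable at p̄ and p̄·(1−p̄)·g′(p̄) = (u_r^R − u_ℓ^R)·p̲_Δ(p̄) − c/λ. In particular g′(p̄) > 0 if and only if p̲_Δ(p̄) > p_ℓ^B := c/(λ(u_r^R − u_ℓ^R)). -/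
/-- The lower belief `p / (p + (1 - p) E)` obeys the logistic equation
`p (1 - p) x' = x (1 - x)`. -/
theorem hasDerivAt_lowerBelief {E p : ℝ} (hp0 : 0 < p) (hp1 : p < 1) (hE : 0 < E) :
    HasDerivAt (fun q : ℝ => q / (q + (1 - q) * E))
      (p / (p + (1 - p) * E) * (1 - p / (p + (1 - p) * E)) / (p * (1 - p))) p := by
  have hq : 0 < 1 - p := sub_pos.mpr hp1
  have hD : p + (1 - p) * E ≠ 0 := by positivity
  have hden : HasDerivAt (fun q : ℝ => q + (1 - q) * E) (1 + -1 * E) p :=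
    (hasDerivAt_id p).add (((hasDerivAt_id p).const_sub 1).mul_const E)
  refine ((hasDerivAt_id' p).fun_div hden hD).congr_deriv ?_
  have hq' := hq.ne'
  field_simp
  ring

/-- Crossing-direction computation in the proof of Lemma 1(ii): at a state
p̄ where value matching V̂(p̄) = U_ℓ(p̲_Δ(p̄)) holds and V̂ satisfies the
randomized-stopping ODE, the gap g(q) = V̂(q) − U_ℓ(p̲_Δ(q)) is differentiable at p̄ with
p̄(1−p̄)g′(p̄) = (u_r^R − u_ℓ^R)·p̲_Δ(p̄) − c/λ; in particular g′(p̄) > 0 iff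
p̲_Δ(p̄) > p_ℓ^B. -/
theorem crossing_direction_region3
    (lam c Δ urR uℓR uℓL : ℝ) (hlam : 0 < lam) (hc : 0 < c)
    (hur : uℓR < urR) (hδ : 0 < uℓL - uℓR)
    (pl : ℝ → ℝ) (hpl : ∀ p : ℝ, pl p = p / (p + (1 - p) * Real.exp Δ))
    (Uℓ : ℝ → ℝ) (hUℓ : ∀ p : ℝ, Uℓ p = p * uℓR + (1 - p) * uℓL)
    (pbar : ℝ) (hp0 : 0 < pbar) (hp1 : pbar < 1)
    (V : ℝ → ℝ) (V' : ℝ)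
    (hdV : HasDerivAt V V' pbar)
    (hODE : pbar * (1 - pbar) * V' =
      (urR - V pbar) * (uℓL - V pbar) / (uℓL - uℓR) - c / lam)
    (hmatch : V pbar = Uℓ (pl pbar)) :
    ∃ g' : ℝ,
      HasDerivAt (fun q => V q - Uℓ (pl q)) g' pbar ∧
      pbar * (1 - pbar) * g' = (urR - uℓR) * pl pbar - c / lam ∧
      (0 < g' ↔ c / (lam * (urR - uℓR)) < pl pbar) := by
  have hq : 0 < 1 - pbar := sub_pos.mpr hp1
  have hpq : 0 < pbar * (1 - pbar) := mul_pos hp0 hq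
  have hdpl : HasDerivAt pl (pl pbar * (1 - pl pbar) / (pbar * (1 - pbar))) pbar := by
    simpa only [← hpl] using hasDerivAt_lowerBelief hp0 hp1 (Real.exp_pos Δ)
  have hdU : HasDerivAt (fun q => Uℓ (pl q))
      (pl pbar * (1 - pl pbar) / (pbar * (1 - pbar)) * uℓR +
        -(pl pbar * (1 - pl pbar) / (pbar * (1 - pbar))) * uℓL) pbar := by
    simp only [hUℓ]
    exact (hdpl.mul_const uℓR).add ((hdpl.const_sub 1).mul_const uℓL)
  have hgap : pbar * (1 - pbar) * (V' - (pl pbar * (1 - pl pbar) / (pbar * (1 - pbar)) * uℓR +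
      -(pl pbar * (1 - pl pbar) / (pbar * (1 - pbar))) * uℓL)) =
      (urR - uℓR) * pl pbar - c / lam := by
    have hV : (urR - V pbar) * (uℓL - V pbar) / (uℓL - uℓR) = (urR - V pbar) * pl pbar := by
      rw [div_eq_iff hδ.ne', hmatch, hUℓ]
      ring
    have hx : pbar * (1 - pbar) * (pl pbar * (1 - pl pbar) / (pbar * (1 - pbar))) =
        pl pbar * (1 - pl pbar) := mul_div_cancel₀ _ hpq.ne'
    rw [hV, hmatch, hUℓ] at hODE
    linear_combination hODE + (uℓL - uℓR) * hx
  refine ⟨_, hdV.sub hdU, hgap, ?_⟩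
  rw [← mul_pos_iff_of_pos_left hpq, hgap, sub_pos, ← div_div,
    div_lt_iff₀' (sub_pos.mpr hur)]
end

section
/- Let λ > 0, c > 0 and payoff parameters satisfying u_r^R > u_ℓ^R, u_ℓ^L > u_r^L, u_r^R > u_r^L and u_ℓ^L > u_ℓ^R; set δ^R := u_r^R − u_ℓ^R, δ^L := u_ℓ^L − u_r^L, δ_r := u_r^R − u_r^L, δ_ℓ := u_ℓ^L − u_ℓ^R. Define u₁ := (u_r^R + u_ℓ^L)/2 − √(((u_r^R − u_ℓ^L)/2)² + (c/λ)·δ_ℓ), the hedging payoff û := (u_r^R·u_ℓ^L − u_r^L·u_ℓ^R)/(δ_r + δ_ℓ), and the low-cost threshold c̲ := λ·δ^R·δ^L·δ_r/(δ_r + δ_ℓ)². Then u₁ > û if and only if c < c̲. -/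
/-- from the proof of Lemma 1(iii): u₁ > û if and only if c < c̲, where
c̲ := λ·δ^R·δ^L·δ_r/(δ_r + δ_ℓ)². -/
theorem u1_gt_uhat_iff_low_cost
    (lam c urR urL uℓR uℓL : ℝ) (hlam : 0 < lam) (hc : 0 < c)
    (h1 : uℓR < urR) (h2 : urL < uℓL) (h3 : urL < urR) (h4 : uℓR < uℓL)
    (u1 uhat clow : ℝ)
    (hu1 : u1 = (urR + uℓL) / 2 -
      Real.sqrt (((urR - uℓL) / 2) ^ 2 + c / lam * (uℓL - uℓR)))
    (huhat : uhat = (urR * uℓL - urL * uℓR) / ((urR - urL) + (uℓL - uℓR)))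
    (hclow : clow = lam * (urR - uℓR) * (uℓL - urL) * (urR - urL) /
      ((urR - urL) + (uℓL - uℓR)) ^ 2) :
    uhat < u1 ↔ c < clow := by
  have hr : 0 < urR - urL := sub_pos.2 h3
  have hℓ : 0 < uℓL - uℓR := sub_pos.2 h4
  have hR : 0 < urR - uℓR := sub_pos.2 h1
  have hL : 0 < uℓL - urL := sub_pos.2 h2
  have hS : 0 < (urR - urL) + (uℓL - uℓR) := add_pos hr hℓ
  have gap_r : urR - uhat = (urR - urL) * (urR - uℓR) / ((urR - urL) + (uℓL - uℓR)) := by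
    rw [huhat, eq_div_iff hS.ne', sub_mul, div_mul_cancel₀ _ hS.ne']
    ring
  have gap_ℓ : uℓL - uhat = (uℓL - urL) * (uℓL - uℓR) / ((urR - urL) + (uℓL - uℓR)) := by
    rw [huhat, eq_div_iff hS.ne', sub_mul, div_mul_cancel₀ _ hS.ne']
    ring
  have gap_r_pos : 0 < urR - uhat := by rw [gap_r]; positivity
  have gap_ℓ_pos : 0 < uℓL - uhat := by rw [gap_ℓ]; positivity
  have gap_mul : (urR - uhat) * (uℓL - uhat) = clow / lam * (uℓL - uℓR) := by
    rw [gap_r, gap_ℓ, hclow, div_mul_div_comm, ← sq, div_div, div_mul_eq_mul_div,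
      div_eq_div_iff (by positivity) (by positivity)]
    ring
  calc uhat < u1
      ↔ Real.sqrt (((urR - uℓL) / 2) ^ 2 + c / lam * (uℓL - uℓR)) <
          (urR + uℓL) / 2 - uhat := by rw [hu1, lt_sub_comm]
    _ ↔ ((urR - uℓL) / 2) ^ 2 + c / lam * (uℓL - uℓR) < ((urR + uℓL) / 2 - uhat) ^ 2 :=
        Real.sqrt_lt' (by linarith)
    _ ↔ c / lam * (uℓL - uℓR) < clow / lam * (uℓL - uℓR) := by
        rw [← gap_mul, show ((urR + uℓL) / 2 - uhat) ^ 2 =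
          ((urR - uℓL) / 2) ^ 2 + (urR - uhat) * (uℓL - uhat) by ring, add_lt_add_iff_left]
    _ ↔ c < clow := by rw [mul_lt_mul_iff_left₀ hℓ, div_lt_div_iff_of_pos_right hlam]
end

section
/- Let λ > 0, c > 0 and payoff parameters with δ_ℓ := u_ℓ^L − u_ℓ^R > 0. Define ũ := (u_r^R + u_ℓ^L)/2 − √(((u_r^R − u_ℓ^L)/2)² + (c/λ)·δ_ℓ) and the stationary stopping rate ν̃ := (λ/δ_ℓ)·(u_r^R − ũ). Then ν̃ > 0, and the hedging identity u_ℓ^L − c/ν̃ = (λ/(ν̃+λ))·u_r^R + (ν̃/(ν̃+λ))·u_ℓ^R − c/(ν̃+λ) holds; moreover, both sides of this identity are equal to ũ. -/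
/-- With the stationary Knightian stopping rate ν̃ = (λ/δ_ℓ)(u_r^R − ũ),
we have ν̃ > 0 and the hedging identity equalizing the state-L and state-R payoffs, both
equal to ũ. -/
theorem knightian_stationary_hedging_identity
    (lam c urR uℓR uℓL : ℝ) (hlam : 0 < lam) (hc : 0 < c)
    (hδ : 0 < uℓL - uℓR)
    (utilde nutilde : ℝ)
    (hut : utilde = (urR + uℓL) / 2 -
      Real.sqrt (((urR - uℓL) / 2) ^ 2 + c / lam * (uℓL - uℓR)))
    (hnu : nutilde = lam / (uℓL - uℓR) * (urR - utilde)) :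
    0 < nutilde ∧
      uℓL - c / nutilde =
        lam / (nutilde + lam) * urR + nutilde / (nutilde + lam) * uℓR -
          c / (nutilde + lam) ∧
      uℓL - c / nutilde = utilde := by
  have hK : 0 < c / lam * (uℓL - uℓR) := by positivity
  have hD : 0 ≤ ((urR - uℓL) / 2) ^ 2 + c / lam * (uℓL - uℓR) := by positivity
  have hroot : (urR - utilde) * (uℓL - utilde) = c / lam * (uℓL - uℓR) := by
    rw [hut]
    linear_combination Real.sq_sqrt hD
  have hA : 0 < urR - utilde := by
    have hlt : |(urR - uℓL) / 2| <
        Real.sqrt (((urR - uℓL) / 2) ^ 2 + c / lam * (uℓL - uℓR)) := by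
      apply Real.lt_sqrt_of_sq_lt
      rw [sq_abs]
      linarith
    linarith [neg_abs_le ((urR - uℓL) / 2)]
  have hpos : 0 < nutilde := by
    rw [hnu]
    positivity
  have hrate : nutilde * (uℓL - uℓR) = lam * (urR - utilde) := by
    rw [hnu]
    field_simp
  have hcost : nutilde * (uℓL - utilde) = c := by
    apply mul_right_cancel₀ hδ.ne'
    have hlamroot : lam * ((urR - utilde) * (uℓL - utilde)) = c * (uℓL - uℓR) := by
      rw [hroot]
      field_simp
    linear_combination (uℓL - utilde) * hrate + hlamroot
  have hL : uℓL - c / nutilde = utilde := by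
    rw [← hcost, mul_div_cancel_left₀ _ hpos.ne']
    ring
  refine ⟨hpos, ?_, hL⟩
  rw [hL]
  have hsum : nutilde + lam ≠ 0 := by positivity
  field_simp
  linear_combination hrate - hcost
end

section
/- Let λ > 0, c > 0, u_r^R ∈ ℝ, and let Ψ be twice differentiable on an open interval I ⊆ (0,1) satisfying the Bayesian HJB ODE c = λq(u_r^R − Ψ(q)) − λq(1−q)Ψ′(q) for all q ∈ I. Then for every q ∈ I and every p ∈ ℝ, c = λ·p·( u_r^R − [Ψ(q) + (p−q)Ψ′(q)] ) − λ·p·(1−p)·Ψ′(q) − λ·q·(1−q)·(p−q)·Ψ″(q). In words: the tangent-line extension V(p, p̄) = Ψ(q(p̄)) + (p − q(p̄))Ψ′(q(p̄)) of a Bayesian value function along a belief path q with q′(p̄) = q(1−q)/(p̄(1−p̄)) satisfies the HJB drift equation −c + λp(u_r^R − V) + V_p·η(p) + V_p̄·η(p̄) = 0 for every evaluation belief p, where η(x) = −λx(1−x). -/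
/-- Verification computation for Region 4: the tangent-line extension of a
Bayesian value function Ψ (solving the Bayesian HJB ODE on an open interval I ⊆ (0,1))
satisfies the HJB drift equation at every evaluation belief p. -/
theorem tangent_line_extension_satisfies_HJB
    (lam c urR : ℝ) (hlam : 0 < lam) (hc : 0 < c)
    (a b : ℝ) (hI : Set.Ioo a b ⊆ Set.Ioo (0 : ℝ) 1)
    (Ψ Ψ' Ψ'' : ℝ → ℝ)
    (hd1 : ∀ q ∈ Set.Ioo a b, HasDerivAt Ψ (Ψ' q) q)
    (hd2 : ∀ q ∈ Set.Ioo a b, HasDerivAt Ψ' (Ψ'' q) q)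
    (hODE : ∀ q ∈ Set.Ioo a b, c = lam * q * (urR - Ψ q) - lam * q * (1 - q) * Ψ' q) :
    ∀ q ∈ Set.Ioo a b, ∀ p : ℝ,
      c = lam * p * (urR - (Ψ q + (p - q) * Ψ' q)) -
            lam * p * (1 - p) * Ψ' q -
            lam * q * (1 - q) * (p - q) * Ψ'' q := by
  intro q hq p
  have hderiv : HasDerivAt
      (fun x => lam * x * (urR - Ψ x) - lam * x * (1 - x) * Ψ' x)
      (lam * (urR - Ψ q) - lam * (1 - q) * Ψ' q - lam * q * (1 - q) * Ψ'' q) q := by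
    have hlin : HasDerivAt (fun x : ℝ => lam * x) lam q := by
      simpa using (hasDerivAt_id q).const_mul lam
    have hone : HasDerivAt (fun x : ℝ => 1 - x) (-1) q := by
      simpa using (hasDerivAt_id q).const_sub 1
    refine ((hlin.mul ((hd1 q hq).const_sub urR)).sub
      ((hlin.mul hone).mul (hd2 q hq))).congr_deriv ?_
    simp only [Pi.mul_apply]
    ring
  have hconst : HasDerivAt
      (fun x => lam * x * (urR - Ψ x) - lam * x * (1 - x) * Ψ' x) 0 q := by
    refine (hasDerivAt_const q c).congr_of_eventuallyEq ?_
    filter_upwards [Ioo_mem_nhds hq.1 hq.2] with x hx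
    exact (hODE x hx).symm
  have hzero := hderiv.unique hconst
  linear_combination hODE q hq - (p - q) * hzero
end

section
/- Let λ > 0, c > 0, δ > 0, and p̄_s ∈ (0,1). Define τ(p̄) := (1/λ)·ln( (p̄/(1−p̄))·((1−p̄_s)/p̄_s) ) and h(p̄) := p̄·(1 − e^{−λ·τ(p̄)})·δ − c·τ(p̄) for p̄ ∈ (0,1). Then h(p̄_s) = 0, h is differentiable at p̄_s, and h′(p̄_s) = (λ·δ·p̄_s − c)/(λ·p̄_s·(1−p̄_s)). In particular, h′(p̄_s) > 0 if and only if p̄_s > c/(λδ); i.e. experimentation for the short time τ(p̄) followed by action ℓ is strictly preferred to immediate action ℓ just above p̄_s exactly when p̄_s exceeds the Bayesian stopping boundary p_ℓ^B = c/(λδ). -/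
/-- In the symmetric model, the gain h(p̄) from experimenting until the
belief reaches p̄_s and then taking action ℓ (relative to immediate ℓ) vanishes at p̄_s,
is differentiable there with h′(p̄_s) = (λδp̄_s − c)/(λp̄_s(1−p̄_s)), and this derivative
is positive iff p̄_s exceeds the Bayesian boundary c/(λδ). -/
theorem experimentation_gain_derivative_at_stopping_state
    (lam c δ ps : ℝ) (hlam : 0 < lam) (hc : 0 < c) (hδ : 0 < δ)
    (hps : ps ∈ Set.Ioo (0 : ℝ) 1)
    (τ h : ℝ → ℝ)
    (hτ : ∀ p : ℝ, τ p = (1 / lam) * Real.log (p / (1 - p) * ((1 - ps) / ps)))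
    (hh : ∀ p : ℝ, h p = p * (1 - Real.exp (-lam * τ p)) * δ - c * τ p) :
    h ps = 0 ∧
    HasDerivAt h ((lam * δ * ps - c) / (lam * ps * (1 - ps))) ps ∧
    (0 < (lam * δ * ps - c) / (lam * ps * (1 - ps)) ↔ c / (lam * δ) < ps) := by
  obtain ⟨h0, h1⟩ := hps
  have h1' : 0 < 1 - ps := sub_pos.2 h1
  have hps0 : ps ≠ 0 := h0.ne'
  have h1ps : 1 - ps ≠ 0 := h1'.ne'
  have hlam0 : lam ≠ 0 := hlam.ne'
  have hodds : ps / (1 - ps) * ((1 - ps) / ps) = 1 := by field_simp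
  have hτ0 : τ ps = 0 := by rw [hτ, hodds, Real.log_one, mul_zero]
  have hτ' : HasDerivAt τ (1 / (lam * ps * (1 - ps))) ps := by
    have hratio : HasDerivAt (fun p : ℝ => p / (1 - p) * ((1 - ps) / ps))
        (1 / (ps * (1 - ps))) ps := by
      refine (((hasDerivAt_id' ps).div ((hasDerivAt_id' ps).const_sub 1) h1ps).mul_const
        ((1 - ps) / ps)).congr_deriv ?_
      field_simp
      ring
    rw [funext hτ]
    refine ((hratio.log (by rw [hodds]; exact one_ne_zero)).const_mul (1 / lam)).congr_deriv ?_
    rw [hodds]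
    field_simp
  refine ⟨by rw [hh, hτ0]; simp, ?_, ?_⟩
  · rw [funext hh]
    refine ((((hasDerivAt_id' ps).mul ((hτ'.const_mul (-lam)).exp.const_sub 1)).mul_const δ).sub
      (hτ'.const_mul c)).congr_deriv ?_
    simp only [hτ0, mul_zero, Real.exp_zero]
    field_simp
    ring
  · rw [div_pos_iff_of_pos_right (by positivity), sub_pos, div_lt_iff₀ (by positivity),
      mul_comm ps]
end
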